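/- ∫_0^1 ln(ln(1/x)) / (1 − x + x²) dx = (2π/√3) · ln( (32π⁵)^{1/6} / Γ(1/6) ). -/

import Mathlib

open MeasureTheory Real
open Set Filter Topology Complex HurwitzZeta

theorem norm_ofReal_cpow_sub_le {m B x y : ℝ} {w : ℂ} (hm : 0 < m)
    (hB : ∀ u, m ≤ u → u ^ (w.re - 1) ≤ B) (hx : m ≤ x) (hy : m ≤ y) :
    ‖(y : ℂ) ^ w - (x : ℂ) ^ w‖ ≤ ‖w‖ * B * |y - x| := by
  refine (convex_Ici m).norm_image_sub_le_of_norm_hasDerivWithin_le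
    (f := fun u : ℝ ↦ (u : ℂ) ^ w) (f' := fun u : ℝ ↦ w * (u : ℂ) ^ (w - 1)) ?_ ?_ hx hy
  · intro u hu
    have hu0 : 0 < u := hm.trans_le hu
    have := ((hasStrictDerivAt_cpow_const (x := (u : ℂ)) (c := w)
      (Or.inl (by simpa using hu0))).hasDerivAt).comp_ofReal
    exact this.hasDerivWithinAt
  · intro u hu
    have hu0 : 0 < u := hm.trans_le hu
    rw [norm_mul, norm_cpow_eq_rpow_re_of_pos hu0]
    gcongr
    simpa using hB u hu

theorem norm_ofReal_cpow_sub_sub_le {m B x y p : ℝ} {w : ℂ} (hm : 0 < m)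
    (hB : ∀ u, m ≤ u → u ^ (w.re - 2) ≤ B) (hx : x ∈ Icc m p) (hy : y ∈ Icc m p) :
    ‖(y : ℂ) ^ w - (x : ℂ) ^ w - w * (p : ℂ) ^ (w - 1) * (y - x)‖
      ≤ ‖w‖ * (‖w - 1‖ * B * (p - m)) * |y - x| := by
  have key := (convex_Icc m p).norm_image_sub_le_of_norm_hasDerivWithin_le
    (f := fun u : ℝ ↦ (u : ℂ) ^ w - w * (p : ℂ) ^ (w - 1) * u)
    (f' := fun u : ℝ ↦ w * (u : ℂ) ^ (w - 1) - w * (p : ℂ) ^ (w - 1))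
    (C := ‖w‖ * (‖w - 1‖ * B * (p - m))) ?_ ?_ hx hy
  · rw [Real.norm_eq_abs] at key
    refine le_trans (le_of_eq ?_) key
    congr 1
    ring
  · intro u hu
    have hu0 : 0 < u := hm.trans_le hu.1
    have h1 := ((hasStrictDerivAt_cpow_const (x := (u : ℂ)) (c := w)
      (Or.inl (by simpa using hu0))).hasDerivAt).comp_ofReal
    have h2 := ((hasDerivAt_id (u : ℂ)).const_mul (w * (p : ℂ) ^ (w - 1))).comp_ofReal
    exact ((h1.sub h2).congr_deriv (by simp)).hasDerivWithinAt
  · intro u hu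
    rw [← mul_sub, norm_mul]
    gcongr
    have hB0 : 0 ≤ B := (rpow_nonneg hm.le _).trans (hB m le_rfl)
    refine (norm_ofReal_cpow_sub_le hm (w := w - 1) (B := B) (x := p) (y := u) ?_
      (hu.1.trans hu.2) hu.1).trans ?_
    · intro v hv
      have : (w - 1).re - 1 = w.re - 2 := by simp; ring
      rw [this]
      exact hB v hv
    · gcongr
      rw [abs_sub_comm, abs_of_nonneg (by linarith [hu.2])]
      linarith [hu.1]

/-- The summand of the Dirichlet series of `2 * hurwitzZetaOdd a`, with its leading term as
`n → ∞` subtracted. -/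
noncomputable def oddZetaTerm (a : ℝ) (n : ℕ) (s : ℂ) : ℂ :=
  1 / (n + a : ℂ) ^ s - 1 / (n + 1 - a : ℂ) ^ s - s * (1 - 2 * a) / (n + 1 : ℂ) ^ (s + 1)

theorem rpow_le_rpow_add_rpow {m u e e₁ e₂ : ℝ} (hm : 0 < m) (hu : m ≤ u) (h₁ : e₁ ≤ e)
    (h₂ : e ≤ e₂) (h₀ : e₂ ≤ 0) : u ^ e ≤ m ^ e₁ + m ^ e₂ := by
  refine (rpow_le_rpow_of_nonpos hm hu (h₂.trans h₀)).trans ?_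
  rcases le_total m 1 with h | h
  · exact (rpow_le_rpow_of_exponent_ge hm h h₁).trans (le_add_of_nonneg_right (by positivity))
  · exact (rpow_le_rpow_of_exponent_le h h₂).trans (le_add_of_nonneg_left (by positivity))

theorem norm_oddZetaTerm_le {a : ℝ} (ha : a ∈ Ioo (0 : ℝ) 1) (n : ℕ) {s : ℂ}
    (hs : s ∈ Metric.ball (3 / 2 : ℂ) 2) :
    ‖oddZetaTerm a n s‖ ≤ 16 * ((n + min a (1 - a)) ^ (-6 : ℝ) +
      (n + min a (1 - a)) ^ (-(3 / 2) : ℝ)) := by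
  obtain ⟨h0, h1⟩ := ha
  rw [mem_ball_iff_norm] at hs
  set b := min a (1 - a) with hb
  have hb0 : 0 < b := lt_min h0 (by linarith)
  have hba : b ≤ a := min_le_left _ _
  have hba' : b ≤ 1 - a := min_le_right _ _
  have hm : 0 < n + b := by positivity
  have hre := (abs_re_le_norm _).trans hs.le
  have hre' : (s - 3 / 2).re = s.re - 3 / 2 := by simp
  rw [hre', abs_le] at hre
  have key := norm_ofReal_cpow_sub_sub_le (m := n + b) (p := n + 1) (x := n + 1 - a) (y := n + a)
    (w := -s) hm (fun u hu ↦ rpow_le_rpow_add_rpow (e₁ := -6) (e₂ := -(3 / 2)) hm hu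
      (by simp; linarith) (by simp; linarith) (by norm_num))
    ⟨by linarith, by linarith⟩ ⟨by linarith, by linarith⟩
  have e : oddZetaTerm a n s = ((n + a : ℝ) : ℂ) ^ (-s) - ((n + 1 - a : ℝ) : ℂ) ^ (-s)
      - -s * ((n + 1 : ℝ) : ℂ) ^ (-s - 1) * ((n + a : ℝ) - (n + 1 - a : ℝ)) := by
    rw [oddZetaTerm, show -s - 1 = -(s + 1) by ring, cpow_neg, cpow_neg, cpow_neg]
    push_cast
    simp only [div_eq_mul_inv]
    ring
  rw [e]
  refine key.trans ?_
  set B := (n + b) ^ (-6 : ℝ) + (n + b) ^ (-(3 / 2) : ℝ) with hB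
  have hB0 : 0 ≤ B := by positivity
  have n1 : ‖-s‖ ≤ 7 / 2 := by
    rw [norm_neg]
    calc ‖s‖ = ‖(s - 3 / 2) + 3 / 2‖ := by ring_nf
      _ ≤ ‖s - 3 / 2‖ + ‖(3 / 2 : ℂ)‖ := norm_add_le _ _
      _ ≤ 7 / 2 := by
        have : ‖(3 / 2 : ℂ)‖ = 3 / 2 := by norm_num
        linarith
  have n2 : ‖-s - 1‖ ≤ 9 / 2 := (norm_sub_le _ _).trans (by rw [norm_one]; linarith)
  have n3 : (n + 1 : ℝ) - (n + b) ≤ 1 := by linarith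
  have n3' : 0 ≤ (n + 1 : ℝ) - (n + b) := by linarith
  have n4 : |(n + a : ℝ) - (n + 1 - a)| ≤ 1 := by rw [abs_le]; constructor <;> linarith
  calc _ ≤ 7 / 2 * (9 / 2 * B * 1) * 1 := by gcongr
    _ ≤ 16 * B := by linarith

theorem summable_nat_add_rpow {b e : ℝ} (hb : 0 < b) (he : e < -1) :
    Summable fun n : ℕ ↦ (n + b) ^ e := by
  refine ((Real.summable_one_div_nat_add_rpow b (-e)).2 (by linarith)).congr fun n ↦ ?_
  rw [abs_of_pos (by positivity), one_div, rpow_neg (by positivity), inv_inv]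

theorem summable_oddZetaTerm_bound {a : ℝ} (ha : a ∈ Ioo (0 : ℝ) 1) :
    Summable fun n : ℕ ↦ 16 * ((n + min a (1 - a)) ^ (-6 : ℝ) +
      (n + min a (1 - a)) ^ (-(3 / 2) : ℝ)) := by
  have hb0 : 0 < min a (1 - a) := lt_min ha.1 (by linarith [ha.2])
  exact ((summable_nat_add_rpow hb0 (by norm_num)).add
    (summable_nat_add_rpow hb0 (by norm_num))).mul_left _

theorem hasDerivAt_one_div_const_cpow {c : ℂ} (hc : c ≠ 0) (s : ℂ) :
    HasDerivAt (fun s : ℂ ↦ 1 / c ^ s) (-Complex.log c / c ^ s) s := by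
  have := (hasDerivAt_neg s).const_cpow (c := c) (Or.inl hc)
  simp only [cpow_neg] at this
  convert this using 1
  · simp
  · ring

theorem hasDerivAt_oddZetaTerm {a : ℝ} (ha : a ∈ Ioo (0 : ℝ) 1) (n : ℕ) (s : ℂ) :
    HasDerivAt (oddZetaTerm a n) (-Complex.log (n + a) / (n + a : ℂ) ^ s
      - -Complex.log (n + 1 - a) / (n + 1 - a : ℂ) ^ s - ((1 - 2 * a) / (n + 1 : ℂ) ^ (s + 1)
      + s * (1 - 2 * a) * (-Complex.log (n + 1) / (n + 1 : ℂ) ^ (s + 1)))) s := by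
  have c1 : (n + a : ℂ) ≠ 0 := by
    have : (n + a : ℝ) ≠ 0 := by have := ha.1; positivity
    exact_mod_cast this
  have c2 : (n + 1 - a : ℂ) ≠ 0 := by
    have : (n + 1 - a : ℝ) ≠ 0 := by
      have := ha.2
      have : (0 : ℝ) ≤ n := by positivity
      linarith
    exact_mod_cast this
  have c3 : (n + 1 : ℂ) ≠ 0 := by exact_mod_cast n.succ_ne_zero
  have h3 := ((hasDerivAt_id s).mul_const (1 - 2 * a : ℂ)).mul
    ((hasDerivAt_one_div_const_cpow c3 (s + 1)).comp_add_const s 1)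
  refine ((((hasDerivAt_one_div_const_cpow c1 s).sub
    (hasDerivAt_one_div_const_cpow c2 s)).sub h3).congr_deriv ?_).congr_of_eventuallyEq ?_
  · simp
    ring
  · refine .of_forall fun z ↦ ?_
    simp [oddZetaTerm]
    ring

theorem two_mul_hurwitzZetaOdd_eq_of_one_lt_re {a : ℝ} (ha : a ∈ Ioo (0 : ℝ) 1) {s : ℂ}
    (hs : 1 < s.re) :
    2 * hurwitzZetaOdd a s = (1 - 2 * a) * riemannZeta₁ (s + 1) + ∑' n, oddZetaTerm a n s := by
  have hs0 : s ≠ 0 := by rintro rfl; simp at hs; linarith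
  have h1 := (hasSum_nat_hurwitzZetaOdd_of_mem_Icc (Ioo_subset_Icc_self ha) hs).mul_left 2
  have hz : 1 < (s + 1).re := by simp; linarith
  have h2 : HasSum (fun n : ℕ ↦ 1 / (n + 1 : ℂ) ^ (s + 1)) (riemannZeta (s + 1)) := by
    rw [zeta_eq_tsum_one_div_nat_add_one_cpow hz]
    refine Summable.hasSum ?_
    exact_mod_cast (summable_nat_add_iff 1).2 (Complex.summable_one_div_nat_cpow.2 hz)
  have h3 := (h1.sub (h2.mul_left (s * (1 - 2 * a))))
  have h4 : ∑' n, oddZetaTerm a n s = _ := (h3.congr_fun fun n ↦ by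
    simp only [oddZetaTerm]; ring).tsum_eq
  rw [h4, riemannZeta_eq_inv_sub_mul (by simpa using hs0), add_sub_cancel_right]
  linear_combination (1 - 2 * a : ℂ) * riemannZeta₁ (s + 1) * mul_inv_cancel₀ hs0

theorem two_mul_hurwitzZetaOdd_eq {a : ℝ} (ha : a ∈ Ioo (0 : ℝ) 1) {s : ℂ}
    (hs : s ∈ Metric.ball (3 / 2 : ℂ) 2) :
    2 * hurwitzZetaOdd a s = (1 - 2 * a) * riemannZeta₁ (s + 1) + ∑' n, oddZetaTerm a n s := by
  have hd : DifferentiableOn ℂ (fun s ↦ ∑' n, oddZetaTerm a n s) (Metric.ball (3 / 2 : ℂ) 2) :=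
    differentiableOn_tsum_of_summable_norm (summable_oddZetaTerm_bound ha)
      (fun n s _ ↦ (hasDerivAt_oddZetaTerm ha n s).differentiableAt.differentiableWithinAt)
      Metric.isOpen_ball fun n s hs ↦ norm_oddZetaTerm_le ha n hs
  refine AnalyticOnNhd.eqOn_of_preconnected_of_eventuallyEq (𝕜 := ℂ)
    (f := fun s ↦ 2 * hurwitzZetaOdd a s)
    (g := fun s ↦ (1 - 2 * a) * riemannZeta₁ (s + 1) + ∑' n, oddZetaTerm a n s)
    (U := Metric.ball (3 / 2 : ℂ) 2) (z₀ := 2) ?_ ?_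
    (convex_ball (3 / 2 : ℂ) 2).isPreconnected ?_ ?_ hs
  · exact ((differentiable_hurwitzZetaOdd a).const_mul 2).differentiableOn.analyticOnNhd
      Metric.isOpen_ball
  · have hz : Differentiable ℂ fun s : ℂ ↦ (1 - 2 * a : ℂ) * riemannZeta₁ (s + 1) := by fun_prop
    exact (hz.differentiableOn.add hd).analyticOnNhd Metric.isOpen_ball
  · rw [mem_ball_iff_norm]; norm_num
  · filter_upwards [(isOpen_lt continuous_const continuous_re).mem_nhds
      (show (1 : ℝ) < (2 : ℂ).re by norm_num)] with z hz
    exact two_mul_hurwitzZetaOdd_eq_of_one_lt_re ha hz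

theorem zero_mem_ball : (0 : ℂ) ∈ Metric.ball (3 / 2 : ℂ) 2 := by
  rw [mem_ball_iff_norm]; norm_num

theorem hurwitzZetaOdd_apply_zero {a : ℝ} (ha : a ∈ Ioo (0 : ℝ) 1) :
    hurwitzZetaOdd a 0 = 1 / 2 - a := by
  have := two_mul_hurwitzZetaOdd_eq ha zero_mem_ball
  simp [oddZetaTerm] at this
  linear_combination this / 2

theorem hasSum_log_sub_log_sub {a : ℝ} (ha : a ∈ Ioo (0 : ℝ) 1) {L : ℝ}
    (h : HasSum (fun n : ℕ ↦ -Real.log (n + a) + Real.log (n + 1 - a) - (1 - 2 * a) / (n + 1)) L) :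
    L = Real.log (Real.Gamma a) - Real.log (Real.Gamma (1 - a))
      - (1 - 2 * a) * eulerMascheroniConstant := by
  refine tendsto_nhds_unique ((tendsto_add_atTop_iff_nat 1).2 h.tendsto_sum_nat) ?_
  have g1 := Real.BohrMollerup.tendsto_log_gamma ha.1
  have g2 := Real.BohrMollerup.tendsto_log_gamma (show 0 < 1 - a by linarith [ha.2])
  have g3 := Real.tendsto_harmonic_sub_log.const_mul (1 - 2 * a)
  have g4 : Tendsto (fun n : ℕ ↦ (1 - 2 * a) * (1 / ((n : ℝ) + 1))) atTop (𝓝 ((1 - 2 * a) * 0)) :=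
    tendsto_one_div_add_atTop_nhds_zero_nat.const_mul _
  have := (g1.sub g2).sub (g3.add g4)
  rw [mul_zero, add_zero] at this
  refine this.congr fun n ↦ ?_
  have hh : (harmonic n : ℝ) = ∑ i ∈ Finset.range n, 1 / ((i : ℝ) + 1) := by
    simp [harmonic]
  rw [Real.BohrMollerup.logGammaSeq, Real.BohrMollerup.logGammaSeq, hh, Finset.sum_sub_distrib,
    Finset.sum_add_distrib, Finset.sum_neg_distrib]
  have s1 : ∑ i ∈ Finset.range (n + 1), (1 - 2 * a) / ((i : ℝ) + 1)
      = (1 - 2 * a) * (∑ i ∈ Finset.range n, 1 / ((i : ℝ) + 1) + 1 / ((n : ℝ) + 1)) := by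
    rw [← Finset.sum_range_succ, Finset.mul_sum]
    simp only [mul_one_div]
  have s2 (x : ℝ) (m : ℕ) : Real.log (x + m) = Real.log (m + x) := by rw [add_comm]
  simp only [s1, s2, add_sub_assoc]
  ring

theorem hasDerivAt_hurwitzZetaOdd_zero {a : ℝ} (ha : a ∈ Ioo (0 : ℝ) 1) :
    HasDerivAt (hurwitzZetaOdd a)
      (((Real.log (Real.Gamma a) - Real.log (Real.Gamma (1 - a))) / 2 : ℝ) : ℂ) 0 := by
  have hU := Metric.isOpen_ball (x := (3 / 2 : ℂ)) (ε := 2)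
  have hF (n : ℕ) : DifferentiableOn ℂ (oddZetaTerm a n) (Metric.ball (3 / 2 : ℂ) 2) :=
    fun s _ ↦ (hasDerivAt_oddZetaTerm ha n s).differentiableAt.differentiableWithinAt
  have hd := differentiableOn_tsum_of_summable_norm (summable_oddZetaTerm_bound ha) hF hU
    fun n s hs ↦ norm_oddZetaTerm_le ha n hs
  have hsum := hasSum_deriv_of_summable_norm (summable_oddZetaTerm_bound ha) hF hU
    (fun n s hs ↦ norm_oddZetaTerm_le ha n hs) zero_mem_ball
  set D := deriv (fun w : ℂ ↦ ∑' i : ℕ, oddZetaTerm a i w) 0 with hD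
  have hT : HasDerivAt (fun w : ℂ ↦ ∑' i : ℕ, oddZetaTerm a i w) D 0 :=
    (hd.differentiableAt (hU.mem_nhds zero_mem_ball)).hasDerivAt
  have hterm (n : ℕ) : deriv (oddZetaTerm a n) 0 = ((-Real.log (n + a) + Real.log (n + 1 - a)
      - (1 - 2 * a) / (n + 1) : ℝ) : ℂ) := by
    rw [(hasDerivAt_oddZetaTerm ha n 0).deriv]
    have p1 : (0 : ℝ) ≤ n + a := by have := ha.1; positivity
    have p2 : (0 : ℝ) ≤ n + 1 - a := by
      have := ha.2
      have : (0 : ℝ) ≤ n := by positivity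
      linarith
    push_cast [ofReal_log p1, ofReal_log p2]
    simp
  simp only [hterm] at hsum
  have hre := hasSum_log_sub_log_sub ha (by simpa only [ofReal_re] using hasSum_re hsum)
  have hDr : D = (D.re : ℂ) := by
    apply Complex.ext
    · simp
    · simpa using (hasSum_im hsum).unique (by simpa only [ofReal_im] using hasSum_zero)
  have hz : HasDerivAt (fun s : ℂ ↦ riemannZeta₁ (s + 1)) eulerMascheroniConstant 0 := by
    have h := (differentiable_riemannZeta₁ (0 + 1)).hasDerivAt
    have h' : deriv riemannZeta₁ (0 + 1) = eulerMascheroniConstant := by simp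
    rw [h'] at h
    exact h.comp_add_const 0 1
  have := ((hz.const_mul (1 - 2 * a : ℂ)).add hT).const_mul (1 / 2)
  refine (this.congr_of_eventuallyEq ?_).congr_deriv ?_
  · filter_upwards [hU.mem_nhds zero_mem_ball] with s hs
    have := two_mul_hurwitzZetaOdd_eq ha hs
    simp only [Pi.add_apply]
    linear_combination this / 2
  · rw [hDr, hre]
    push_cast
    ring

theorem one_sub_add_sq_pos {c r : ℝ} (hc : c < 1) (hr : 0 < r) : 0 < 1 - 2 * r * c + r ^ 2 := by
  nlinarith [sq_nonneg (1 - r), mul_pos hr (sub_pos.2 hc)]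

theorem cos_two_pi_mul_lt_one {a : ℝ} (ha : a ∈ Ioo (0 : ℝ) 1) : Real.cos (2 * π * a) < 1 := by
  have : 0 < Real.sin (π * a) :=
    Real.sin_pos_of_pos_of_lt_pi (mul_pos pi_pos ha.1) (by nlinarith [pi_pos, ha.2])
  rw [mul_assoc, Real.cos_two_mul, Real.cos_sq']
  nlinarith

/-- The conjugate Poisson kernel, as a function of `t` where the radius is `exp (-t)`. -/
noncomputable def conjPoisson (a t : ℝ) : ℝ :=
  Real.sin (2 * π * a) * Real.exp (-t) /
    (1 - 2 * Real.exp (-t) * Real.cos (2 * π * a) + Real.exp (-t) ^ 2)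

theorem hasSum_conjPoisson (a : ℝ) {t : ℝ} (ht : 0 < t) :
    HasSum (fun n : ℕ ↦ Real.sin (2 * π * a * n) * Real.exp (-n * t)) (conjPoisson a t) := by
  set z : ℂ := Real.exp (-t) * cexp ((2 * π * a : ℝ) * I) with hz
  have hn : ‖z‖ < 1 := by
    rw [hz, norm_mul, norm_exp_ofReal_mul_I, norm_real, Real.norm_eq_abs, abs_of_pos (by positivity)]
    simpa using ht
  have h := hasSum_im (hasSum_geometric_of_norm_lt_one hn)
  convert h using 1
  · ext n
    have : z ^ n = (Real.exp (-n * t) : ℝ) * cexp ((2 * π * a * n : ℝ) * I) := by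
      rw [hz, mul_pow, ← Complex.exp_nat_mul, ← ofReal_pow, ← Real.exp_nat_mul]
      congr 2
      · ring_nf
      · push_cast; ring
    rw [this, im_ofReal_mul, exp_ofReal_mul_I_im, mul_comm]
  · have hre : z.re = Real.exp (-t) * Real.cos (2 * π * a) := by
      rw [hz, re_ofReal_mul, exp_ofReal_mul_I_re]
    have him : z.im = Real.exp (-t) * Real.sin (2 * π * a) := by
      rw [hz, im_ofReal_mul, exp_ofReal_mul_I_im]
    rw [inv_im, normSq_apply, sub_re, sub_im, hre, him, conjPoisson]
    congr 1
    · simp; ring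
    · simp
      linear_combination -(Real.exp (-t) ^ 2) * Real.sin_sq_add_cos_sq (2 * π * a)

theorem continuous_conjPoisson {a : ℝ} (ha : a ∈ Ioo (0 : ℝ) 1) : Continuous (conjPoisson a) := by
  unfold conjPoisson
  refine Continuous.div (by fun_prop) (by fun_prop) fun t ↦ ?_
  exact (one_sub_add_sq_pos (cos_two_pi_mul_lt_one ha) (Real.exp_pos _)).ne'

theorem mellin_conjPoisson (a : ℝ) {s : ℂ} (hs : 1 < s.re) :
    mellin (fun t ↦ (conjPoisson a t : ℂ)) s = Complex.Gamma s * sinZeta a s := by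
  have h := hasSum_mellin (a := fun n : ℕ ↦ (Real.sin (2 * π * a * n) : ℂ)) (p := fun n ↦ n)
    (F := fun t ↦ (conjPoisson a t : ℂ)) (s := s) ?_ (by linarith) ?_ ?_
  · refine h.unique (((hasSum_nat_sinZeta a hs).mul_left (Complex.Gamma s)).congr_fun fun n ↦ ?_)
    simp [mul_div_assoc]
  · intro n
    rcases Nat.eq_zero_or_pos n with rfl | hn
    · simp
    · right; exact_mod_cast hn
  · intro t ht
    exact_mod_cast hasSum_conjPoisson a ht
  · refine Summable.of_nonneg_of_le (fun n ↦ by positivity) (fun n ↦ ?_)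
      (Real.summable_one_div_nat_rpow.2 hs)
    gcongr
    rw [norm_real]
    exact Real.abs_sin_le_one _

theorem hasDerivAt_mellin_conjPoisson {a : ℝ} (ha : a ∈ Ioo (0 : ℝ) 1) :
    HasDerivAt (mellin fun t ↦ (conjPoisson a t : ℂ))
      ((∫ t in Ioi 0, Real.log t * conjPoisson a t : ℝ) : ℂ) 1 := by
  have hc : Continuous fun t ↦ (conjPoisson a t : ℂ) :=
    continuous_ofReal.comp (continuous_conjPoisson ha)
  have h := (mellin_hasDerivAt_of_isBigO_rpow (a := 2) (b := 0) (s := 1)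
    (f := fun t ↦ (conjPoisson a t : ℂ)) (hc.locallyIntegrable.locallyIntegrableOn _)
    ?_ (by simp) ?_ (by simp)).2
  · refine h.congr_deriv ?_
    rw [mellin]
    simp only [sub_self, cpow_zero, one_smul, Complex.real_smul, ← ofReal_mul]
    exact integral_ofReal
  · refine Asymptotics.IsBigO.trans ?_ (isLittleO_exp_neg_mul_rpow_atTop one_pos (-2)).isBigO
    have hl : Tendsto (fun t ↦ Real.sin (2 * π * a) /
        (1 - 2 * Real.exp (-t) * Real.cos (2 * π * a) + Real.exp (-t) ^ 2)) atTop
        (𝓝 (Real.sin (2 * π * a) / (1 - 2 * 0 * Real.cos (2 * π * a) + 0 ^ 2))) := by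
      have he := Real.tendsto_exp_neg_atTop_nhds_zero
      refine tendsto_const_nhds.div (((he.const_mul 2).mul_const _).const_sub 1 |>.add (he.pow 2)) ?_
      simp
    have h1 := (hl.isBigO_one ℝ).mul (Asymptotics.isBigO_refl (fun t ↦ Real.exp (-1 * t)) atTop)
    rw [← Asymptotics.isBigO_norm_left]
    simp only [norm_real]
    rw [Asymptotics.isBigO_norm_left]
    refine (h1.congr_right (by simp)).congr_left fun t ↦ ?_
    rw [conjPoisson, neg_one_mul]
    ring
  · simp only [neg_zero, rpow_zero]
    exact (hc.continuousAt.tendsto.mono_left nhdsWithin_le_nhds).isBigO_one ℝ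

theorem HasDerivAt.eq_of_eqOn_one_lt_re {f g : ℂ → ℂ} {f' g' : ℂ} (hf : HasDerivAt f f' 1)
    (hg : HasDerivAt g g' 1) (h : ∀ s : ℂ, 1 < s.re → f s = g s) : f' = g' := by
  have hf1 := (HasDerivAt.comp_ofReal (z := 1) (by simpa using hf)).hasDerivWithinAt (s := Ioi 1)
  have hg1 := (HasDerivAt.comp_ofReal (z := 1) (by simpa using hg)).hasDerivWithinAt (s := Ioi 1)
  have he : ∀ x ∈ Ioi (1 : ℝ), f x = g x := fun x hx ↦ h x (by simpa using hx)
  refine (uniqueDiffWithinAt_Ioi (1 : ℝ)).eq_deriv _ (hf1.congr (fun x hx ↦ (he x hx).symm) ?_) hg1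
  exact tendsto_nhds_unique_of_eventuallyEq hg1.continuousWithinAt hf1.continuousWithinAt
    (eventually_nhdsWithin_of_forall fun x hx ↦ (he x hx).symm)

theorem two_mul_sin_mul_Gamma_mul_sinZeta (a : UnitAddCircle) {s : ℂ} (hs : 0 < s.re) :
    2 * Complex.sin (π * s / 2) * (Complex.Gamma s * sinZeta a s) =
      (2 * π : ℂ) ^ s * hurwitzZetaOdd a (1 - s) := by
  rw [hurwitzZetaOdd_one_sub, cpow_neg]
  · have : (2 * π : ℂ) ^ s ≠ 0 := by
      rw [Ne, cpow_eq_zero_iff]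
      simp [pi_ne_zero]
    field_simp
  · rintro n rfl
    simp at hs
    linarith [(Nat.cast_nonneg n : (0 : ℝ) ≤ n)]

/-- **Malmsten's integral** with a general angle, in exponential variables. -/
theorem integral_log_mul_conjPoisson {a : ℝ} (ha : a ∈ Ioo (0 : ℝ) 1) :
    ∫ t in Ioi 0, Real.log t * conjPoisson a t =
      π / 2 * ((1 - 2 * a) * Real.log (2 * π) + Real.log (Real.Gamma (1 - a))
        - Real.log (Real.Gamma a)) := by
  have hsin : HasDerivAt (fun s : ℂ ↦ 2 * Complex.sin (π * s / 2)) 0 1 := by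
    have h := ((((hasDerivAt_id (1 : ℂ)).const_mul (π : ℂ)).div_const 2).csin).const_mul 2
    exact h.congr_deriv (by simp [Complex.cos_pi_div_two])
  have hpow : HasDerivAt (fun s : ℂ ↦ (2 * π : ℂ) ^ s) (2 * π * Complex.log (2 * π)) 1 := by
    have h := (hasDerivAt_id (1 : ℂ)).const_cpow (c := (2 * π : ℂ)) (Or.inl (by simp [pi_ne_zero]))
    exact h.congr_deriv (by simp)
  have hH : HasDerivAt (fun s : ℂ ↦ hurwitzZetaOdd a (1 - s)) _ 1 :=
    HasDerivAt.comp_const_sub (1 : ℂ) 1 (by simpa using hasDerivAt_hurwitzZetaOdd_zero ha)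
  have key := (hsin.mul (hasDerivAt_mellin_conjPoisson ha)).eq_of_eqOn_one_lt_re (hpow.mul hH)
    fun s hs ↦ by
      simp only [Pi.mul_apply]
      rw [mellin_conjPoisson a hs, two_mul_sin_mul_Gamma_mul_sinZeta _ (by linarith)]
  have hlog : Complex.log (2 * π) = (Real.log (2 * π) : ℝ) := by
    rw [ofReal_log (by positivity)]; push_cast; rfl
  simp only [sub_self, hurwitzZetaOdd_apply_zero ha, cpow_one, zero_mul, zero_add, mul_one,
    Complex.sin_pi_div_two, hlog] at key
  have key' : 2 * ∫ t in Ioi 0, Real.log t * conjPoisson a t =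
      2 * π * Real.log (2 * π) * (1 / 2 - a) + 2 * π *
        -((Real.log (Real.Gamma a) - Real.log (Real.Gamma (1 - a))) / 2) := by
    apply ofReal_injective
    push_cast at key ⊢
    linear_combination key
  linear_combination key' / 2

theorem integral_Ioo_zero_one_eq_integral_exp_neg (g : ℝ → ℝ) :
    ∫ x in Ioo (0 : ℝ) 1, g x = ∫ t in Ioi 0, Real.exp (-t) * g (Real.exp (-t)) := by
  have himg : (fun t : ℝ ↦ Real.exp (-t)) '' Ioi 0 = Ioo 0 1 := by
    ext x
    constructor
    · rintro ⟨t, ht, rfl⟩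
      exact ⟨Real.exp_pos _, by simpa using ht⟩
    · rintro ⟨h0, h1⟩
      exact ⟨-Real.log x, by simpa using Real.log_neg h0 h1, by simp [Real.exp_log h0]⟩
  rw [← himg, integral_image_eq_integral_abs_deriv_smul (f' := fun t ↦ -Real.exp (-t))
    measurableSet_Ioi]
  · simp
  · intro t _
    exact ((hasDerivAt_neg t).exp.congr_deriv (by simp)).hasDerivWithinAt
  · intro x _ y _ h
    simpa using h

theorem malmsten_integral_two :
    ∫ x in Set.Ioo (0 : ℝ) 1, Real.log (Real.log (1 / x)) / (1 - x + x ^ 2)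
      = (2 * Real.pi / Real.sqrt 3) *
          Real.log ((32 * Real.pi ^ 5) ^ ((1 : ℝ) / 6) / Real.Gamma (1 / 6)) := by
  have ha : (1 / 6 : ℝ) ∈ Ioo (0 : ℝ) 1 := by norm_num
  have h3 : Real.sqrt 3 ≠ 0 := by positivity
  have hang : 2 * π * (1 / 6) = π / 3 := by ring
  have hint : ∫ x in Ioo (0 : ℝ) 1, Real.log (Real.log (1 / x)) / (1 - x + x ^ 2) =
      2 / √3 * ∫ t in Ioi 0, Real.log t * conjPoisson (1 / 6) t := by
    rw [integral_Ioo_zero_one_eq_integral_exp_neg, ← integral_const_mul]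
    congr with t
    rw [conjPoisson, hang, Real.sin_pi_div_three, Real.cos_pi_div_three, one_div, ← Real.exp_neg,
      neg_neg, Real.log_exp]
    field_simp
  have hG : 0 < Real.Gamma (1 / 6) := Real.Gamma_pos_of_pos (by norm_num)
  have hrefl : Real.Gamma (1 - 1 / 6) = 2 * π / Real.Gamma (1 / 6) := by
    have := Real.Gamma_mul_Gamma_one_sub (1 / 6)
    rw [mul_one_div, Real.sin_pi_div_six] at this
    rw [eq_div_iff hG.ne']
    linear_combination this
  have h32 : 32 * π ^ 5 = (2 * π) ^ 5 := by ring
  rw [hint, integral_log_mul_conjPoisson ha, hrefl, Real.log_div (by positivity) hG.ne',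
    Real.log_div (by positivity) hG.ne', Real.log_rpow (by positivity), h32, Real.log_pow]
  field_simp
  push_cast
  ring
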